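/- arXiv:1112.4521 — 11 statements merged into one kernel-verified Lean document; each statement's English description precedes it below -/
import Mathlib

section
/- Let r be a prime, let a, b be coprime integers, and let l be a prime with l ≢ 1 (mod r) that divides a^r + b^r. Then l divides a + b. -/
/-- In `ZMod l`, the `r`-th power map is injective when `r` is coprime to `l - 1`. -/
theorem ZMod.pow_left_injective_of_coprime {l r : ℕ} [Fact l.Prime] (hr : r ≠ 0)
    (h : r.Coprime (l - 1)) : Function.Injective fun x : ZMod l => x ^ r := by
  intro x y hxy
  simp only at hxy
  by_cases hy : y = 0
  · rw [hy, zero_pow hr] at hxy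
    rw [hy, eq_zero_of_pow_eq_zero hxy]
  have hx : x ≠ 0 := by
    rintro rfl
    rw [zero_pow hr] at hxy
    exact pow_ne_zero r hy hxy.symm
  have h₁ : (x / y) ^ r = 1 := by
    rw [div_pow, hxy, div_self (pow_ne_zero r hy)]
  have h₂ : (x / y) ^ (l - 1) = 1 := ZMod.pow_card_sub_one_eq_one (div_ne_zero hx hy)
  have h₃ : orderOf (x / y) = 1 :=
    Nat.eq_one_of_dvd_coprimes h (orderOf_dvd_of_pow_eq_one h₁) (orderOf_dvd_of_pow_eq_one h₂)
  exact (div_eq_one_iff_eq hy).mp (orderOf_eq_one_iff.mp h₃)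

/-- If `a, b` are coprime integers, `r` is a prime, and `l` is a prime with `l ≢ 1 (mod r)`
dividing `a^r + b^r`, then `l` divides `a + b`. -/
theorem prime_not_one_mod_r_dvd_sum
    (r : ℕ) (hr : r.Prime) (a b : ℤ) (hab : IsCoprime a b)
    (l : ℕ) (hl : l.Prime) (hl1 : l % r ≠ 1)
    (hdvd : (l : ℤ) ∣ a ^ r + b ^ r) :
    (l : ℤ) ∣ a + b := by
  have : Fact l.Prime := ⟨hl⟩
  have hcop : r.Coprime (l - 1) := by
    refine (Nat.Prime.coprime_iff_not_dvd hr).mpr fun hd => hl1 ?_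
    have h := (Nat.modEq_iff_dvd' hl.one_le).mpr hd
    rw [← h, Nat.mod_eq_of_lt hr.one_lt]
  have hneg : (-(b : ZMod l)) ^ r = -(b : ZMod l) ^ r := by
    rcases hr.eq_two_or_odd' with rfl | hodd
    · obtain rfl : l = 2 := hl.eq_two_or_odd.resolve_right hl1
      rw [ZMod.neg_eq_self_mod_two, ZMod.neg_eq_self_mod_two]
    · exact hodd.neg_pow _
  rw [← ZMod.intCast_zmod_eq_zero_iff_dvd] at hdvd ⊢
  push_cast at hdvd ⊢
  refine eq_neg_iff_add_eq_zero.mp (ZMod.pow_left_injective_of_coprime hr.ne_zero hcop ?_)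
  simp only [hneg]
  exact eq_neg_of_add_eq_zero_left hdvd
end

section
/- Let r be an odd prime and let a, b be coprime integers. Then every prime q dividing φ_r(a,b) satisfies q = r or q ≡ 1 (mod r). -/
/-- For an odd prime `r`, the homogeneous polynomial
`φ_r(x,y) = Σ_{i=0}^{r-1} (-1)^i x^(r-1-i) y^i`, so that `x^r + y^r = (x+y)·φ_r(x,y)`. -/
def phiR (r : ℕ) (x y : ℤ) : ℤ :=
  ∑ i ∈ Finset.range r, (-1) ^ i * x ^ (r - 1 - i) * y ^ i

/-- In `ZMod q`, a root `z` of `1 + X + ⋯ + X ^ (r - 1)` with `r` prime exists only if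
`q = r` or `q ≡ 1 (mod r)`. -/
theorem eq_or_mod_eq_one_of_geom_sum_eq_zero {r q : ℕ} (hr : r.Prime) (hq : q.Prime)
    {z : ZMod q} (hz : ∑ i ∈ Finset.range r, z ^ i = 0) : q = r ∨ q % r = 1 := by
  have := Fact.mk hr
  have := Fact.mk hq
  by_cases h1 : z = 1
  · left
    have h0 : (r : ZMod q) = 0 := by simpa [h1] using hz
    exact (Nat.prime_dvd_prime_iff_eq hq hr).1 ((ZMod.natCast_eq_zero_iff r q).1 h0)
  · right
    have hpow : z ^ r = 1 := by
      have h := geom_sum_mul z r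
      rw [hz, zero_mul] at h
      exact sub_eq_zero.1 h.symm
    have hz0 : z ≠ 0 := by
      rintro rfl
      simp [hr.ne_zero] at hpow
    have hdvd : r ∣ q - 1 :=
      orderOf_eq_prime hpow h1 ▸ orderOf_dvd_of_pow_eq_one (ZMod.pow_card_sub_one_eq_one hz0)
    have hmod : 1 % r = q % r := (Nat.modEq_iff_dvd' hq.one_le).2 hdvd
    rw [← hmod, Nat.mod_eq_of_lt hr.one_lt]

/-- If `a, b` are coprime integers, then every prime `q` dividing `φ_r(a,b)` satisfies
`q = r` or `q ≡ 1 (mod r)`. -/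
theorem prime_divisors_of_phi
    (r : ℕ) (hr : r.Prime) (hodd : Odd r)
    (a b : ℤ) (hab : IsCoprime a b)
    (q : ℕ) (hq : q.Prime) (hdvd : (q : ℤ) ∣ phiR r a b) :
    q = r ∨ q % r = 1 := by
  have := Fact.mk hq
  have hsum : ∑ i ∈ Finset.range r, (a : ZMod q) ^ (r - 1 - i) * (-(b : ZMod q)) ^ i = 0 := by
    have h := (ZMod.intCast_zmod_eq_zero_iff_dvd _ q).2 hdvd
    rw [phiR] at h
    push_cast at h
    rw [← h]
    refine Finset.sum_congr rfl fun i _ => ?_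
    rw [neg_pow (b : ZMod q)]
    ring
  have ha : (a : ZMod q) ≠ 0 := by
    intro ha
    have hpow : (-(b : ZMod q)) ^ r = 0 := by
      have h := geom_sum₂_mul (-(b : ZMod q)) (a : ZMod q) r
      simp_rw [mul_comm ((-(b : ZMod q)) ^ _)] at h
      rw [hsum, ha, zero_pow hr.ne_zero, zero_mul, sub_zero] at h
      exact h.symm
    have hb : (b : ZMod q) = 0 := neg_eq_zero.1 (eq_zero_of_pow_eq_zero hpow)
    obtain ⟨u, v, huv⟩ := hab
    have h := congrArg (Int.cast : ℤ → ZMod q) huv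
    simp [ha, hb] at h
  refine eq_or_mod_eq_one_of_geom_sum_eq_zero (z := -(b : ZMod q) / a) hr hq ?_
  refine (mul_eq_zero.1 ?_).resolve_left (pow_ne_zero (r - 1) ha)
  rw [← hsum, Finset.mul_sum]
  refine Finset.sum_congr rfl fun i hi => ?_
  have hi' : r - 1 = (r - 1 - i) + i := by
    have := Finset.mem_range.1 hi
    omega
  nth_rewrite 1 [hi']
  rw [pow_add, mul_assoc, ← mul_pow, mul_div_cancel₀ _ ha]
end

section
/- Let a, b be coprime integers, let N be a nonzero integer with 13 ∤ N, let p ≥ 2 be an integer, and let c be an integer with a^13 + b^13 = N·c^p. Then 13 divides c if and only if 13 divides a + b. -/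
/-- Fermat's little theorem, applied to a sum of two `q`-th powers. -/
theorem Int.prime_dvd_pow_add_pow_iff {q : ℕ} (hq : q.Prime) (a b : ℤ) :
    (q : ℤ) ∣ a ^ q + b ^ q ↔ (q : ℤ) ∣ a + b := by
  have : Fact q.Prime := ⟨hq⟩
  simp only [← ZMod.intCast_zmod_eq_zero_iff_dvd, Int.cast_add, Int.cast_pow, ZMod.pow_card]

/-- If `a, b` are coprime integers, `N` is a nonzero integer with `13 ∤ N`, `p ≥ 2`, and
`a^13 + b^13 = N·c^p`, then `13 ∣ c ↔ 13 ∣ a + b`. -/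
theorem thirteen_dvd_c_iff_dvd_sum
    (a b c N : ℤ) (hab : IsCoprime a b) (hN0 : N ≠ 0) (hN13 : ¬ (13 ∣ N))
    (p : ℕ) (hp : 2 ≤ p) (heq : a ^ 13 + b ^ 13 = N * c ^ p) :
    (13 ∣ c) ↔ (13 ∣ a + b) := by
  have h13 : Prime (13 : ℤ) := by norm_num
  have hsum : (13 : ℤ) ∣ a ^ 13 + b ^ 13 ↔ 13 ∣ a + b :=
    Int.prime_dvd_pow_add_pow_iff (q := 13) (by norm_num) a b
  rw [← hsum, heq, h13.dvd_mul, or_iff_right hN13, h13.dvd_pow_iff_dvd (by omega)]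
end

section
/- Let d ∈ {3, 5, 7, 11}, let γ be a nonzero integer all of whose prime divisors l satisfy l ≢ 1 (mod 13), and let p be a prime. Suppose a, b, c are integers with gcd(a,b) = 1, abc ≠ 0, and a^13 + b^13 = d·γ·c^p. Then d divides a + b, and there exists a positive integer c₀, all of whose prime divisors are ≡ 1 (mod 13), such that φ(a,b) = c₀^p if 13 ∤ a + b, and φ(a,b) = 13·c₀^p if 13 | a + b. -/
/-- `φ(x,y) = φ_13(x,y) = Σ_{i=0}^{12} (-1)^i x^(12-i) y^i`, so that
`x^13 + y^13 = (x+y)·φ(x,y)`. -/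
def phi13 (x y : ℤ) : ℤ :=
  ∑ i ∈ Finset.range 13, (-1) ^ i * x ^ (12 - i) * y ^ i

theorem phi13_eq (x y : ℤ) :
    phi13 x y = x ^ 12 - x ^ 11 * y + x ^ 10 * y ^ 2 - x ^ 9 * y ^ 3 + x ^ 8 * y ^ 4
      - x ^ 7 * y ^ 5 + x ^ 6 * y ^ 6 - x ^ 5 * y ^ 7 + x ^ 4 * y ^ 8 - x ^ 3 * y ^ 9
      + x ^ 2 * y ^ 10 - x * y ^ 11 + y ^ 12 := by
  simp only [phi13, Finset.sum_range_succ, Finset.sum_range_zero]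
  norm_num
  ring

theorem add_mul_phi13 (x y : ℤ) : (x + y) * phi13 x y = x ^ 13 + y ^ 13 := by
  rw [phi13_eq]
  ring

/-- The binomial expansion of `φ(s - y, y)` around `s = 0`. -/
theorem exists_phi13_eq (x y : ℤ) :
    ∃ t : ℤ, phi13 x y = 13 * y ^ 12 + 13 * (x + y) * t + (x + y) ^ 12 := by
  obtain ⟨s, rfl⟩ : ∃ s, x = s - y := ⟨x + y, by ring⟩
  refine ⟨-6 * y ^ 11 + 22 * s * y ^ 10 - 55 * s ^ 2 * y ^ 9 + 99 * s ^ 3 * y ^ 8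
    - 132 * s ^ 4 * y ^ 7 + 132 * s ^ 5 * y ^ 6 - 99 * s ^ 6 * y ^ 5 + 55 * s ^ 7 * y ^ 4
    - 22 * s ^ 8 * y ^ 3 + 6 * s ^ 9 * y ^ 2 - s ^ 10 * y, ?_⟩
  rw [phi13_eq]
  ring

theorem phi13_pos {a b : ℤ} (h : a ^ 13 + b ^ 13 ≠ 0) : 0 < phi13 a b := by
  have hodd : Odd 13 := by decide
  have hmul := add_mul_phi13 a b
  have hs : a + b ≠ 0 := fun h0 => h (by rw [← hmul, h0, zero_mul])
  rcases lt_or_gt_of_ne hs with hneg | hpos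
  · have hlt : a ^ 13 < (-b) ^ 13 := hodd.strictMono_pow (by linarith)
    rw [hodd.neg_pow] at hlt
    exact pos_of_mul_neg_right (by rw [hmul]; linarith) hneg.le
  · have hlt : (-b) ^ 13 < a ^ 13 := hodd.strictMono_pow (by linarith)
    rw [hodd.neg_pow] at hlt
    exact pos_of_mul_pos_right (by rw [hmul]; linarith) hpos.le

/-- For a prime `q ≢ 1 (mod 13)`, the map `x ↦ x ^ 13` is injective modulo `q`. -/
theorem dvd_add_of_dvd_pow_add_pow {q : ℕ} (hq : q.Prime) (hq1 : q % 13 ≠ 1) {a b : ℤ}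
    (h : (q : ℤ) ∣ a ^ 13 + b ^ 13) : (q : ℤ) ∣ a + b := by
  have := Fact.mk hq
  rw [← ZMod.intCast_zmod_eq_zero_iff_dvd] at h ⊢
  push_cast at h ⊢
  generalize (a : ZMod q) = x at *
  generalize (b : ZMod q) = y at *
  by_cases hy : y = 0
  · subst hy
    simpa using h
  by_contra hxy
  have hu : (-x / y) ^ 13 = 1 := by
    rw [div_pow, div_eq_one_iff_eq (pow_ne_zero _ hy), Odd.neg_pow (by decide)]
    linear_combination -h
  have hu1 : -x / y ≠ 1 := by
    rw [Ne, div_eq_one_iff_eq hy]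
    intro h'
    exact hxy (by linear_combination -h')
  have : Fact (Nat.Prime 13) := ⟨by norm_num⟩
  have hord := orderOf_eq_prime hu hu1
  have hdvd := ZMod.orderOf_dvd_card_sub_one (p := q) (a := -x / y) (by
    intro h0
    rw [h0] at hu
    norm_num at hu)
  rw [hord] at hdvd
  have := hq.two_le
  omega

theorem not_dvd_of_isCoprime_of_dvd_add {q : ℕ} (hq : q.Prime) {a b : ℤ}
    (hab : IsCoprime a b) (h : (q : ℤ) ∣ a + b) : ¬ (q : ℤ) ∣ b := fun hb =>
  (Nat.prime_iff_prime_int.mp hq).not_isUnit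
    (hab.isUnit_of_dvd' ((dvd_add_left hb).mp h) hb)

/-- Away from `13`, the factors `a + b` and `φ(a,b)` have no common prime. -/
theorem not_dvd_add_of_dvd_phi13 {q : ℕ} (hq : q.Prime) (hq13 : q ≠ 13) {a b : ℤ}
    (hab : IsCoprime a b) (h : (q : ℤ) ∣ phi13 a b) : ¬ (q : ℤ) ∣ a + b := by
  intro hs
  have hqi := Nat.prime_iff_prime_int.mp hq
  obtain ⟨t, ht⟩ := exists_phi13_eq a b
  have hd : (q : ℤ) ∣ 13 * b ^ 12 := by
    have h1 : (q : ℤ) ∣ 13 * (a + b) * t + (a + b) ^ 12 :=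
      dvd_add ((hs.mul_left 13).mul_right t) (hs.trans (dvd_pow_self _ (by norm_num)))
    rw [ht, add_assoc] at h
    exact (dvd_add_left h1).mp h
  rcases hqi.dvd_or_dvd hd with h13 | hb
  · exact hq13 ((Nat.prime_dvd_prime_iff_eq hq (by norm_num)).mp (by exact_mod_cast h13))
  · exact not_dvd_of_isCoprime_of_dvd_add hq hab hs (hqi.dvd_of_dvd_pow hb)

theorem mod_eq_one_of_dvd_phi13 {q : ℕ} (hq : q.Prime) (hq13 : q ≠ 13) {a b : ℤ}
    (hab : IsCoprime a b) (h : (q : ℤ) ∣ phi13 a b) : q % 13 = 1 := by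
  by_contra hq1
  exact not_dvd_add_of_dvd_phi13 hq hq13 hab h
    (dvd_add_of_dvd_pow_add_pow hq hq1 (add_mul_phi13 a b ▸ h.mul_left (a + b)))

/-- Removing the factor `13` when `13 ∣ a + b` leaves a number prime to `13`. -/
theorem exists_phi13_eq_thirteen_mul {a b : ℤ} (hab : IsCoprime a b) (h : 13 ∣ a + b) :
    ∃ m : ℤ, phi13 a b = 13 * m ∧ ¬ 13 ∣ m := by
  have h13 : Nat.Prime 13 := by norm_num
  have hb : ¬ (13 : ℤ) ∣ b := not_dvd_of_isCoprime_of_dvd_add h13 hab h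
  obtain ⟨t, ht⟩ := exists_phi13_eq a b
  obtain ⟨k, hk⟩ := h
  refine ⟨b ^ 12 + 13 * (k * t + 13 ^ 10 * k ^ 12), by rw [ht, hk]; ring, fun hm => hb ?_⟩
  exact (Nat.prime_iff_prime_int.mp h13).dvd_of_dvd_pow
    ((dvd_add_left (dvd_mul_right _ _)).mp hm)

theorem not_thirteen_dvd_phi13 {a b : ℤ} (h : ¬ 13 ∣ a + b) : ¬ 13 ∣ phi13 a b := fun h' =>
  h (dvd_add_of_dvd_pow_add_pow (q := 13) (a := a) (b := b) (by norm_num) (by norm_num)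
    (add_mul_phi13 a b ▸ h'.mul_left (a + b)))

theorem Int.isCoprime_of_forall_prime {m n : ℤ}
    (h : ∀ q : ℕ, q.Prime → (q : ℤ) ∣ m → ¬ (q : ℤ) ∣ n) : IsCoprime m n := by
  rw [Int.isCoprime_iff_nat_coprime]
  exact Nat.coprime_of_dvd fun q hq hm hn =>
    h q hq (Int.natCast_dvd.mpr hm) (Int.natCast_dvd.mpr hn)

/-- If `m * n = k * c ^ p` with `m` coprime to both `n` and `k`, then `m` is a `p`-th power. -/
theorem Int.exists_pos_pow_eq_of_mul_eq_mul_pow {m n k c : ℤ} {p : ℕ} (hp : p ≠ 0)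
    (hm : 0 < m) (hmn : IsCoprime m n) (hmk : IsCoprime m k) (h : m * n = k * c ^ p) :
    ∃ c₀ : ℤ, 0 < c₀ ∧ m = c₀ ^ p := by
  obtain ⟨t, ht⟩ : m ∣ c ^ p := hmk.dvd_of_dvd_mul_left (Dvd.intro _ h)
  have hn : n = k * t := by
    apply mul_left_cancel₀ hm.ne'
    rw [h, ht]
    ring
  obtain ⟨e, he⟩ := exists_associated_pow_of_mul_eq_pow'
    (hmn.of_isCoprime_of_dvd_right (Dvd.intro_left k hn.symm)) ht.symm
  have habs : m = |e| ^ p := by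
    rw [← abs_pow, ← abs_of_pos hm, abs_eq_abs, ← Int.associated_iff]
    exact he.symm
  refine ⟨|e|, abs_pos.mpr fun h0 => hm.ne' ?_, habs⟩
  rw [habs, h0, abs_zero, zero_pow hp]

/-- If `d ∈ {3,5,7,11}`, `γ` is a nonzero integer all of whose prime divisors are
`≢ 1 (mod 13)`, `p` is prime and `(a,b,c)` is a non-trivial primitive solution of
`x^13 + y^13 = d·γ·z^p`, then `d ∣ a + b` and there is a positive integer `c₀`, all of
whose prime divisors are `≡ 1 (mod 13)`, with `φ(a,b) = c₀^p` if `13 ∤ a + b` and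
`φ(a,b) = 13·c₀^p` if `13 ∣ a + b`. -/
theorem descent_to_phi_equation
    (d : ℤ) (hd : d = 3 ∨ d = 5 ∨ d = 7 ∨ d = 11)
    (γ : ℤ) (hγ0 : γ ≠ 0)
    (hγ : ∀ l : ℕ, l.Prime → (l : ℤ) ∣ γ → l % 13 ≠ 1)
    (p : ℕ) (hp : p.Prime)
    (a b c : ℤ) (hab : IsCoprime a b) (habc : a * b * c ≠ 0)
    (heq : a ^ 13 + b ^ 13 = d * γ * c ^ p) :
    d ∣ a + b ∧
      ∃ c₀ : ℤ, 0 < c₀ ∧ (∀ q : ℕ, q.Prime → (q : ℤ) ∣ c₀ → q % 13 = 1) ∧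
        (¬ (13 ∣ a + b) → phi13 a b = c₀ ^ p) ∧
        ((13 ∣ a + b) → phi13 a b = 13 * c₀ ^ p) := by
  have hdl : ∃ l : ℕ, l.Prime ∧ l < 13 ∧ (l : ℤ) = d := by
    rcases hd with rfl | rfl | rfl | rfl
    exacts [⟨3, by norm_num⟩, ⟨5, by norm_num⟩, ⟨7, by norm_num⟩, ⟨11, by norm_num⟩]
  obtain ⟨l, hl, hl13, rfl⟩ := hdl
  have hc : c ≠ 0 := right_ne_zero_of_mul habc
  have hpos : 0 < phi13 a b := phi13_pos (by
    rw [heq]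
    exact mul_ne_zero (mul_ne_zero (by exact_mod_cast hl.ne_zero) hγ0) (pow_ne_zero _ hc))
  refine ⟨dvd_add_of_dvd_pow_add_pow hl (by omega)
    (heq ▸ (dvd_mul_right _ _).mul_right _), ?_⟩
  have key : ∀ e m : ℤ, e ∣ 13 → 0 < m → phi13 a b = e * m → ¬ 13 ∣ m →
      ∃ c₀ : ℤ, 0 < c₀ ∧ (∀ q : ℕ, q.Prime → (q : ℤ) ∣ c₀ → q % 13 = 1) ∧ m = c₀ ^ p := by
    intro e m he hm hphi h13
    have hq13 : ∀ q : ℕ, (q : ℤ) ∣ m → q ≠ 13 := fun q hqm hq => h13 (by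
      subst hq
      exact hqm)
    have hdvd : ∀ q : ℕ, (q : ℤ) ∣ m → (q : ℤ) ∣ phi13 a b := fun q hqm =>
      hphi ▸ hqm.mul_left e
    have hmod : ∀ q : ℕ, q.Prime → (q : ℤ) ∣ m → q % 13 = 1 := fun q hq hqm =>
      mod_eq_one_of_dvd_phi13 hq (hq13 q hqm) hab (hdvd q hqm)
    have hmn : IsCoprime m (e * (a + b)) := by
      refine Int.isCoprime_of_forall_prime fun q hq hqm hqn => ?_
      rcases (Nat.prime_iff_prime_int.mp hq).dvd_or_dvd hqn with hqe | hqs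
      · exact hq13 q hqm ((Nat.prime_dvd_prime_iff_eq hq (by norm_num)).mp
          (by exact_mod_cast hqe.trans he))
      · exact not_dvd_add_of_dvd_phi13 hq (hq13 q hqm) hab (hdvd q hqm) hqs
    have hmk : IsCoprime m (l * γ) := by
      refine Int.isCoprime_of_forall_prime fun q hq hqm hqn => ?_
      rcases (Nat.prime_iff_prime_int.mp hq).dvd_or_dvd hqn with hql | hqγ
      · have hql' : q = l := (Nat.prime_dvd_prime_iff_eq hq hl).mp (by exact_mod_cast hql)
        have := hmod q hq hqm
        omega
      · exact hγ q hq hqγ (hmod q hq hqm)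
    obtain ⟨c₀, hc₀, hmc⟩ := Int.exists_pos_pow_eq_of_mul_eq_mul_pow hp.ne_zero hm hmn hmk
      (c := c) (by rw [← heq, ← add_mul_phi13, hphi]; ring)
    exact ⟨c₀, hc₀, fun q hq hqc =>
      hmod q hq (hmc ▸ hqc.trans (dvd_pow_self _ hp.ne_zero)), hmc⟩
  by_cases h13 : 13 ∣ a + b
  · obtain ⟨m, hphi, hm13⟩ := exists_phi13_eq_thirteen_mul hab h13
    obtain ⟨c₀, hc₀, hq, hmc⟩ := key 13 m dvd_rfl (by linarith) hphi hm13
    exact ⟨c₀, hc₀, hq, fun h => absurd h13 h, fun _ => hmc ▸ hphi⟩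
  · obtain ⟨c₀, hc₀, hq, hmc⟩ :=
      key 1 (phi13 a b) (one_dvd _) hpos (one_mul _).symm (not_thirteen_dvd_phi13 h13)
    exact ⟨c₀, hc₀, hq, fun _ => hmc, fun h => absurd h h13⟩
end

section
/- Let ζ be a primitive 13th root of unity and let a, b be coprime integers. Then: (a) every prime ideal of ℤ[ζ] containing both φ₁(a,b) and φ₂(a,b) contains 13; (b) if 13 ∤ a + b, then 1 − ζ divides neither φ₁(a,b) nor φ₂(a,b) in ℤ[ζ]; (c) if 13 | a + b, then for each i ∈ {1,2}, (1 − ζ)^6 divides φᵢ(a,b) in ℤ[ζ] but (1 − ζ)^7 does not. -/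
open NumberField

/-- The factor `∏_{i ∈ s} (a + ζ^i b)` of `φ_13(a,b)` in a commutative ring containing `ζ`. -/
def phiFactor {R : Type*} [CommRing R] (ζ : R) (s : Finset ℕ) (a b : ℤ) : R :=
  ∏ i ∈ s, ((a : R) + ζ ^ i * (b : R))

namespace IsPrimitiveRoot

variable {R : Type*} [CommRing R] [IsDomain R] {ζ : R} {p : ℕ}

theorem one_sub_pow_dvd_prime (hζ : IsPrimitiveRoot ζ p) (hp : p.Prime) :
    (1 - ζ) ^ (p - 1) ∣ (p : R) := by
  have : Fact p.Prime := ⟨hp⟩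
  have key : (p : R) = ∏ μ ∈ primitiveRoots p R, (1 - μ) := by
    rw [← Polynomial.eval_one_cyclotomic_prime (R := R) (p := p),
      Polynomial.cyclotomic_eq_prod_X_sub_primitiveRoots hζ, Polynomial.eval_prod]
    simp
  rw [key, ← Nat.totient_prime hp, ← hζ.card_primitiveRoots, ← Finset.prod_const]
  refine Finset.prod_dvd_prod_of_dvd _ _ fun μ hμ ↦ ?_
  obtain ⟨i, -, rfl⟩ := hζ.eq_pow_of_pow_eq_one
    ((mem_primitiveRoots hp.pos).1 hμ).pow_eq_one
  exact one_sub_dvd_one_sub_pow ζ i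

theorem one_sub_dvd_intCast_iff (hζ : IsPrimitiveRoot ζ p) (hp : p.Prime)
    (hπ : ¬ IsUnit (1 - ζ)) (n : ℤ) : (1 - ζ) ∣ (n : R) ↔ (p : ℤ) ∣ n := by
  have hdvd : (1 - ζ) ∣ (p : R) :=
    (dvd_pow_self _ (by have := hp.two_le; lia)).trans (hζ.one_sub_pow_dvd_prime hp)
  refine ⟨fun h ↦ ?_, fun ⟨m, hm⟩ ↦ ?_⟩
  · by_contra hn
    obtain ⟨u, v, huv⟩ := (Nat.prime_iff_prime_int.1 hp).coprime_iff_not_dvd.2 hn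
    have h1 : (1 : R) = u * p + v * n := by exact_mod_cast congrArg (Int.cast (R := R)) huv.symm
    exact hπ (isUnit_of_dvd_one
      ((dvd_add (hdvd.mul_left _) (h.mul_left _)).trans h1.symm.dvd))
  · rw [hm]
    push_cast
    exact hdvd.mul_right _

/-- Modulo `1 - ζ`, every factor of `phiFactor ζ s a b` is `a + b`. -/
theorem not_one_sub_dvd_phiFactor (hζ : IsPrimitiveRoot ζ p) (hp : p.Prime)
    (hπ : Prime (1 - ζ)) {a b : ℤ} (h : ¬ (p : ℤ) ∣ a + b) (s : Finset ℕ) :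
    ¬ (1 - ζ) ∣ phiFactor ζ s a b := by
  intro hdvd
  obtain ⟨i, -, hi⟩ := (hπ.dvd_finsetProd_iff _).1 hdvd
  refine h ((hζ.one_sub_dvd_intCast_iff hp hπ.not_isUnit _).1 ?_)
  have : ((a + b : ℤ) : R) = (a + ζ ^ i * b) + (1 - ζ ^ i) * b := by push_cast; ring
  rw [this]
  exact dvd_add hi ((one_sub_dvd_one_sub_pow ζ i).mul_right _)

theorem exists_add_pow_mul_eq_one_sub_mul (hζ : IsPrimitiveRoot ζ p) (hp : p.Prime)
    (hp2 : p ≠ 2) (hπ : Prime (1 - ζ)) {a b : ℤ} (hab : IsCoprime a b)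
    (h : (p : ℤ) ∣ a + b) {i : ℕ} (hi : i.Coprime p) :
    ∃ c : R, (a : R) + ζ ^ i * b = (1 - ζ) * c ∧ ¬ (1 - ζ) ∣ c := by
  obtain ⟨m, hm⟩ := h
  obtain ⟨d, hd⟩ : (1 - ζ) ^ 2 ∣ (p : R) :=
    (pow_dvd_pow _ (by have := hp.two_le; lia)).trans (hζ.one_sub_pow_dvd_prime hp)
  refine ⟨(1 - ζ) * (d * m) - (∑ j ∈ Finset.range i, ζ ^ j) * b, ?_, fun hdvd ↦ ?_⟩
  · have hm' : (a : R) = p * m - b := by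
      rw [eq_sub_iff_add_eq]
      exact_mod_cast congrArg (Int.cast (R := R)) hm
    linear_combination hm' + m * hd + b * mul_neg_geom_sum ζ i
  · rw [dvd_sub_right (dvd_mul_right _ _),
      (hζ.geom_sum_isUnit hp.two_le hi).dvd_mul_left,
      hζ.one_sub_dvd_intCast_iff hp hπ.not_isUnit] at hdvd
    have hdvd' : (p : ℤ) ∣ a := (dvd_add_left hdvd).1 ⟨m, hm⟩
    exact (Nat.prime_iff_prime_int.1 hp).not_isUnit (hab.isUnit_of_dvd' hdvd' hdvd)

theorem one_sub_pow_card_dvd_phiFactor (hζ : IsPrimitiveRoot ζ p) (hp : p.Prime)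
    (hp2 : p ≠ 2) (hπ : Prime (1 - ζ)) {a b : ℤ} (hab : IsCoprime a b)
    (h : (p : ℤ) ∣ a + b) {s : Finset ℕ} (hs : ∀ i ∈ s, i.Coprime p) :
    (1 - ζ) ^ s.card ∣ phiFactor ζ s a b ∧ ¬ (1 - ζ) ^ (s.card + 1) ∣ phiFactor ζ s a b := by
  choose! c hc hcπ using fun i (hi : i ∈ s) ↦
    hζ.exists_add_pow_mul_eq_one_sub_mul hp hp2 hπ hab h (hs i hi)
  have key : phiFactor ζ s a b = (1 - ζ) ^ s.card * ∏ i ∈ s, c i := by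
    rw [phiFactor, Finset.prod_congr rfl hc, Finset.prod_mul_distrib, Finset.prod_const]
  rw [key, pow_succ, mul_dvd_mul_iff_left (pow_ne_zero _ hπ.ne_zero)]
  refine ⟨dvd_mul_right _ _, fun hdvd ↦ ?_⟩
  obtain ⟨i, hi, hdvd⟩ := (hπ.dvd_finsetProd_iff _).1 hdvd
  exact hcπ i hi hdvd

theorem prime_mem_of_phiFactor_mem (hζ : IsPrimitiveRoot ζ p) (hp : p.Prime)
    {a b : ℤ} (hab : IsCoprime a b) {s t : Finset ℕ} (hst : Disjoint s t)
    (hs : ∀ i ∈ s, i < p) (ht : ∀ j ∈ t, j < p) (P : Ideal R) (hP : P.IsPrime)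
    (h₁ : phiFactor ζ s a b ∈ P) (h₂ : phiFactor ζ t a b ∈ P) : (p : R) ∈ P := by
  obtain ⟨i, his, hi⟩ := hP.prod_mem_iff.1 h₁
  obtain ⟨j, hjt, hj⟩ := hP.prod_mem_iff.1 h₂
  obtain ⟨u, v, huv⟩ := hab
  have huv' : (u : R) * a + v * b = 1 := by exact_mod_cast congrArg (Int.cast (R := R)) huv
  have hsub : ζ ^ i - ζ ^ j ∈ P := by
    have : ζ ^ i - ζ ^ j = (v - ζ ^ j * u) * (a + ζ ^ i * b) + (ζ ^ i * u - v) * (a + ζ ^ j * b) := by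
      linear_combination -(ζ ^ i - ζ ^ j) * huv'
    rw [this]
    exact P.add_mem (P.mul_mem_left _ hi) (P.mul_mem_left _ hj)
  have hroot (k : ℕ) : ζ ^ k ∈ Polynomial.nthRootsFinset p (1 : R) := by
    rw [Polynomial.mem_nthRootsFinset hp.pos, pow_right_comm, hζ.pow_eq_one, one_pow]
  have hne : ζ ^ i ≠ ζ ^ j := fun h ↦
    Finset.disjoint_left.1 hst his (hζ.pow_inj (hs i his) (ht j hjt) h ▸ hjt)
  exact P.mem_of_dvd ((hζ.nthRootsFinset_pairwise_associated_sub_one_sub_of_prime hp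
    (hroot i) (hroot j) hne).symm.dvd.trans (hζ.sub_one_dvd_natCast hp.one_lt)) hsub

end IsPrimitiveRoot

/-- For `ζ` a primitive 13th root of unity, `φ₁(x,y) = ∏_{i∈{1,3,4,9,10,12}} (x + ζ^i y)` and
`φ₂(x,y) = ∏_{i∈{2,5,6,7,8,11}} (x + ζ^i y)`, and `a, b` coprime integers:
(a) every prime ideal of `ℤ[ζ]` containing both `φ₁(a,b)` and `φ₂(a,b)` contains `13`;
(b) if `13 ∤ a + b` then `1 - ζ` divides neither `φ₁(a,b)` nor `φ₂(a,b)`;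
(c) if `13 ∣ a + b` then `(1-ζ)^6` divides each `φᵢ(a,b)` but `(1-ζ)^7` does not. -/
theorem phi1_phi2_coprime_outside_13
    (K : Type) [Field K] [Algebra ℚ K] [IsCyclotomicExtension {13} ℚ K]
    (ζ : 𝓞 K) (hζ : IsPrimitiveRoot ζ 13)
    (a b : ℤ) (hab : IsCoprime a b) :
    (∀ P : Ideal (𝓞 K), P.IsPrime →
        phiFactor ζ {1, 3, 4, 9, 10, 12} a b ∈ P →
        phiFactor ζ {2, 5, 6, 7, 8, 11} a b ∈ P → (13 : 𝓞 K) ∈ P) ∧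
    (¬ ((13 : ℤ) ∣ a + b) →
        ¬ (1 - ζ) ∣ phiFactor ζ {1, 3, 4, 9, 10, 12} a b ∧
        ¬ (1 - ζ) ∣ phiFactor ζ {2, 5, 6, 7, 8, 11} a b) ∧
    (((13 : ℤ) ∣ a + b) →
        ((1 - ζ) ^ 6 ∣ phiFactor ζ {1, 3, 4, 9, 10, 12} a b ∧
          ¬ (1 - ζ) ^ 7 ∣ phiFactor ζ {1, 3, 4, 9, 10, 12} a b) ∧
        ((1 - ζ) ^ 6 ∣ phiFactor ζ {2, 5, 6, 7, 8, 11} a b ∧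
          ¬ (1 - ζ) ^ 7 ∣ phiFactor ζ {2, 5, 6, 7, 8, 11} a b)) := by
  have hp : Nat.Prime 13 := by norm_num
  have : Fact (Nat.Prime 13) := ⟨hp⟩
  have : CharZero K := algebraRat.charZero K
  obtain rfl : ‹Algebra ℚ K› = DivisionRing.toRatAlgebra := Subsingleton.elim _ _
  have hπ : Prime (1 - ζ) := by
    have hζK : IsPrimitiveRoot (ζ : K) 13 :=
      hζ.map_of_injective RingOfIntegers.coe_injective
    rw [← neg_sub]
    exact hζK.zeta_sub_one_prime'.neg
  refine ⟨fun P hP h₁ h₂ ↦ ?_, fun h ↦ ⟨?_, ?_⟩, fun h ↦ ⟨?_, ?_⟩⟩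
  · exact hζ.prime_mem_of_phiFactor_mem hp hab (by decide) (by decide) (by decide) P hP h₁ h₂
  · exact hζ.not_one_sub_dvd_phiFactor hp hπ h _
  · exact hζ.not_one_sub_dvd_phiFactor hp hπ h _
  · exact hζ.one_sub_pow_card_dvd_phiFactor hp (by decide) hπ hab h (by decide)
  · exact hζ.one_sub_pow_card_dvd_phiFactor hp (by decide) hπ hab h (by decide)
end

section
/- Let ζ be a primitive 13th root of unity and set c₁ = ζ + ζ^12, c₂ = ζ^4 + ζ^9, c₃ = ζ^3 + ζ^10, and θ = ζ + ζ^3 + ζ^4 + ζ^9 + ζ^10 + ζ^12. Then the elementary symmetric functions of c₁, c₂, c₃ are: c₁ + c₂ + c₃ = θ, c₁c₂ + c₂c₃ + c₃c₁ = −1, and c₁c₂c₃ = 1 − θ. In particular, the polynomial φ₁(x,y) = (x² + c₁xy + y²)(x² + c₂xy + y²)(x² + c₃xy + y²) has all its coefficients in the quadratic field ℚ(θ) = ℚ(√13). -/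
/-- Let `ζ` be a primitive 13th root of unity, `c₁ = ζ + ζ^12`, `c₂ = ζ^4 + ζ^9`,
`c₃ = ζ^3 + ζ^10` and `θ = ζ + ζ^3 + ζ^4 + ζ^9 + ζ^10 + ζ^12`. Then the elementary
symmetric functions of `c₁, c₂, c₃` are `c₁ + c₂ + c₃ = θ`,
`c₁c₂ + c₂c₃ + c₃c₁ = -1` and `c₁c₂c₃ = 1 - θ`; in particular the polynomial
`φ₁(x,y) = (x² + c₁xy + y²)(x² + c₂xy + y²)(x² + c₃xy + y²)` has all its coefficients
in `ℚ(θ) = ℚ(√13)`. -/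
theorem elementary_symmetric_of_c
    (F : Type*) [Field F] (ζ : F) (hζ : IsPrimitiveRoot ζ 13) :
    (ζ + ζ ^ 12) + (ζ ^ 4 + ζ ^ 9) + (ζ ^ 3 + ζ ^ 10) =
        ζ + ζ ^ 3 + ζ ^ 4 + ζ ^ 9 + ζ ^ 10 + ζ ^ 12 ∧
      (ζ + ζ ^ 12) * (ζ ^ 4 + ζ ^ 9) + (ζ ^ 4 + ζ ^ 9) * (ζ ^ 3 + ζ ^ 10) +
          (ζ ^ 3 + ζ ^ 10) * (ζ + ζ ^ 12) = -1 ∧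
      (ζ + ζ ^ 12) * (ζ ^ 4 + ζ ^ 9) * (ζ ^ 3 + ζ ^ 10) =
        1 - (ζ + ζ ^ 3 + ζ ^ 4 + ζ ^ 9 + ζ ^ 10 + ζ ^ 12) := by
  have h13 : ζ ^ 13 = 1 := hζ.pow_eq_one
  have hsum := hζ.geom_sum_eq_zero (by norm_num)
  simp only [Finset.sum_range_succ, Finset.sum_range_zero] at hsum
  refine ⟨by ring, ?_, ?_⟩
  · linear_combination (ζ + ζ ^ 2 + ζ ^ 3 + ζ ^ 6 + ζ ^ 8 + ζ ^ 9) * h13 + hsum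
  · linear_combination (2 + ζ ^ 2 + ζ ^ 5 + ζ ^ 6 + ζ ^ 7 + ζ ^ 11 + ζ ^ 13 + ζ ^ 18) * h13 + hsum
end

section
/- Let ζ be a primitive 13th root of unity and set c₁ = ζ + ζ^12, c₂ = ζ^4 + ζ^9, c₃ = ζ^3 + ζ^10, and θ = ζ + ζ^3 + ζ^4 + ζ^9 + ζ^10 + ζ^12. Then (c₂ − c₃)(c₃ − c₁)(c₁ − c₂) = 1 + 2θ. (Equivalently, the product α·β·γ of the coefficients of the Frey-curve construction equals the square root of 13 lying in ℚ(ζ).) -/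
/-- Let `ζ` be a primitive 13th root of unity, `c₁ = ζ + ζ^12`, `c₂ = ζ^4 + ζ^9`,
`c₃ = ζ^3 + ζ^10` and `θ = ζ + ζ^3 + ζ^4 + ζ^9 + ζ^10 + ζ^12`. Then
`(c₂ - c₃)(c₃ - c₁)(c₁ - c₂) = 1 + 2θ`, i.e. the product `α·β·γ` of the coefficients of
the Frey-curve construction is the square root of 13 lying in `ℚ(ζ)`. -/
theorem product_of_differences_eq_sqrt13
    (F : Type*) [Field F] (ζ : F) (hζ : IsPrimitiveRoot ζ 13) :
    ((ζ ^ 4 + ζ ^ 9) - (ζ ^ 3 + ζ ^ 10)) * ((ζ ^ 3 + ζ ^ 10) - (ζ + ζ ^ 12)) *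
        ((ζ + ζ ^ 12) - (ζ ^ 4 + ζ ^ 9)) =
      1 + 2 * (ζ + ζ ^ 3 + ζ ^ 4 + ζ ^ 9 + ζ ^ 10 + ζ ^ 12) := by
  have h := hζ.geom_sum_eq_zero (by norm_num)
  simp only [Finset.sum_range_succ, Finset.sum_range_zero] at h
  linear_combination
    (-1 - ζ + 2 * ζ ^ 2 - 2 * ζ ^ 3 + 3 * ζ ^ 5 - 2 * ζ ^ 6 + ζ ^ 8 - ζ ^ 9 - ζ ^ 11
      + ζ ^ 12 - ζ ^ 14 + 3 * ζ ^ 15 - 3 * ζ ^ 16 + ζ ^ 18 + ζ ^ 19 - 2 * ζ ^ 21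
      + ζ ^ 22) * h
end

section
/- Let ζ be a primitive 13th root of unity and set α = −ζ^10 + ζ^9 + ζ^4 − ζ^3, β = −ζ^12 + ζ^10 + ζ^3 − ζ, γ = ζ^12 − ζ^9 − ζ^4 + ζ. Then each of α, β, γ is divisible by (1 − ζ)² in ℤ[ζ] but not by (1 − ζ)³. (Equivalently, each of α, β, γ has valuation 1 at the prime of the real sextic subfield K of ℚ(ζ) lying above 13.) -/
open NumberField

/-- For `a`, `b` coprime to `n` and `1 - ζ` a nonzero nonunit, any associate of
`(ζ ^ a - 1) * (ζ ^ b - 1)` is divisible by `(1 - ζ) ^ 2` but not by `(1 - ζ) ^ 3`. -/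
theorem IsPrimitiveRoot.one_sub_sq_dvd_and_not_cube_dvd {R : Type*} [CommRing R] [IsDomain R]
    {ζ : R} {n a b : ℕ} (hζ : IsPrimitiveRoot ζ n) (ha : a.Coprime n) (hb : b.Coprime n)
    (h0 : 1 - ζ ≠ 0) (hu : ¬ IsUnit (1 - ζ)) {x : R}
    (hx : Associated ((ζ ^ a - 1) * (ζ ^ b - 1)) x) :
    (1 - ζ) ^ 2 ∣ x ∧ ¬ (1 - ζ) ^ 3 ∣ x := by
  have h : Associated ((1 - ζ) ^ 2) x := by
    have := (hζ.associated_sub_one_pow_sub_one_of_coprime ha).mul_mul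
      (hζ.associated_sub_one_pow_sub_one_of_coprime hb)
    rw [← sq, ← neg_sq, neg_sub] at this
    exact this.trans hx
  refine ⟨h.dvd, fun h3 => ?_⟩
  have := (pow_dvd_pow_iff h0 hu).1 (h3.trans h.symm.dvd)
  omega

/-- Let `ζ` be a primitive 13th root of unity and `α = -ζ^10 + ζ^9 + ζ^4 - ζ^3`,
`β = -ζ^12 + ζ^10 + ζ^3 - ζ`, `γ = ζ^12 - ζ^9 - ζ^4 + ζ`. Each of `α, β, γ` is divisible
by `(1 - ζ)^2` in `ℤ[ζ]` but not by `(1 - ζ)^3`; equivalently each has valuation `1` at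
the prime of the real sextic subfield of `ℚ(ζ)` above `13`. -/
theorem alpha_beta_gamma_valuation
    (K : Type) [Field K] [Algebra ℚ K] [IsCyclotomicExtension {13} ℚ K]
    (ζ : 𝓞 K) (hζ : IsPrimitiveRoot ζ 13) :
    ((1 - ζ) ^ 2 ∣ (-ζ ^ 10 + ζ ^ 9 + ζ ^ 4 - ζ ^ 3) ∧
      ¬ (1 - ζ) ^ 3 ∣ (-ζ ^ 10 + ζ ^ 9 + ζ ^ 4 - ζ ^ 3)) ∧
    ((1 - ζ) ^ 2 ∣ (-ζ ^ 12 + ζ ^ 10 + ζ ^ 3 - ζ) ∧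
      ¬ (1 - ζ) ^ 3 ∣ (-ζ ^ 12 + ζ ^ 10 + ζ ^ 3 - ζ)) ∧
    ((1 - ζ) ^ 2 ∣ (ζ ^ 12 - ζ ^ 9 - ζ ^ 4 + ζ) ∧
      ¬ (1 - ζ) ^ 3 ∣ (ζ ^ 12 - ζ ^ 9 - ζ ^ 4 + ζ)) := by
  have : Fact (Nat.Prime 13) := ⟨by norm_num⟩
  have : CharZero K := algebraRat.charZero K
  obtain rfl : ‹Algebra ℚ K› = DivisionRing.toRatAlgebra := Subsingleton.elim _ _
  have hK : IsPrimitiveRoot (ζ : K) 13 := hζ.map_of_injective RingOfIntegers.coe_injective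
  have hp : Prime (1 - ζ) := by
    simpa using (show Prime (ζ - 1) from hK.zeta_sub_one_prime').neg
  have hz : IsUnit ζ := hζ.isUnit (by norm_num)
  refine ⟨hζ.one_sub_sq_dvd_and_not_cube_dvd (a := 6) (b := 1) (by norm_num) (by norm_num)
      hp.ne_zero hp.not_isUnit ?_,
    hζ.one_sub_sq_dvd_and_not_cube_dvd (a := 9) (b := 2) (by norm_num) (by norm_num)
      hp.ne_zero hp.not_isUnit ?_,
    hζ.one_sub_sq_dvd_and_not_cube_dvd (a := 8) (b := 3) (by norm_num) (by norm_num)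
      hp.ne_zero hp.not_isUnit ?_⟩
  · exact ⟨(hz.pow 3).neg.unit, by simp only [IsUnit.unit_spec]; ring⟩
  · exact ⟨hz.neg.unit, by simp only [IsUnit.unit_spec]; ring⟩
  · exact ⟨hz.unit, by simp only [IsUnit.unit_spec]; ring⟩
end

section
/- Let ζ be a primitive 13th root of unity, c₁ = ζ + ζ^12, c₂ = ζ^4 + ζ^9, c₃ = ζ^3 + ζ^10, fᵢ(x,y) = x² + cᵢ·xy + y², α = c₂ − c₃, β = c₃ − c₁, γ = c₁ − c₂, and let ψ be the field automorphism of ℚ(ζ) determined by ψ(ζ) = ζ^9. Then for all rational x, y: ψ(α·f₁(x,y)) = β·f₂(x,y), ψ(β·f₂(x,y)) = γ·f₃(x,y), and ψ(γ·f₃(x,y)) = α·f₁(x,y). In particular, setting A = α·f₁(x,y), B = β·f₂(x,y), C = γ·f₃(x,y), the symmetric expressions AB + BC + CA and ABC are fixed by ψ, and hence lie in the quadratic subfield ℚ(√13) of ℚ(ζ). -/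
/-- `A = α·f₁(x,y)` where `α = c₂ - c₃` and `f₁(x,y) = x² + c₁xy + y²`. -/
def freyA {K : Type*} [Field K] (ζ : K) (x y : ℚ) : K :=
  ((ζ ^ 4 + ζ ^ 9) - (ζ ^ 3 + ζ ^ 10)) *
    ((x : K) ^ 2 + (ζ + ζ ^ 12) * (x : K) * (y : K) + (y : K) ^ 2)

/-- `B = β·f₂(x,y)` where `β = c₃ - c₁` and `f₂(x,y) = x² + c₂xy + y²`. -/
def freyB {K : Type*} [Field K] (ζ : K) (x y : ℚ) : K :=
  ((ζ ^ 3 + ζ ^ 10) - (ζ + ζ ^ 12)) *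
    ((x : K) ^ 2 + (ζ ^ 4 + ζ ^ 9) * (x : K) * (y : K) + (y : K) ^ 2)

/-- `C = γ·f₃(x,y)` where `γ = c₁ - c₂` and `f₃(x,y) = x² + c₃xy + y²`. -/
def freyC {K : Type*} [Field K] (ζ : K) (x y : ℚ) : K :=
  ((ζ + ζ ^ 12) - (ζ ^ 4 + ζ ^ 9)) *
    ((x : K) ^ 2 + (ζ ^ 3 + ζ ^ 10) * (x : K) * (y : K) + (y : K) ^ 2)

section GaussianPeriods

variable {K : Type*} [Field K] {ζ : K} {ψ : K ≃+* K}

theorem map_first_period (h : ζ ^ 13 = 1) (hψ : ψ ζ = ζ ^ 9) :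
    ψ (ζ + ζ ^ 12) = ζ ^ 4 + ζ ^ 9 := by
  have h₁ : (ζ ^ 9) ^ 12 = ζ ^ 4 := by
    rw [← pow_mul, pow_eq_pow_mod _ h]
  rw [map_add, map_pow, hψ, h₁, add_comm]

theorem map_second_period (h : ζ ^ 13 = 1) (hψ : ψ ζ = ζ ^ 9) :
    ψ (ζ ^ 4 + ζ ^ 9) = ζ ^ 3 + ζ ^ 10 := by
  have h₁ : (ζ ^ 9) ^ 4 = ζ ^ 10 := by
    rw [← pow_mul, pow_eq_pow_mod _ h]
  have h₂ : (ζ ^ 9) ^ 9 = ζ ^ 3 := by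
    rw [← pow_mul, pow_eq_pow_mod _ h]
  rw [map_add, map_pow, map_pow, hψ, h₁, h₂, add_comm]

theorem map_third_period (h : ζ ^ 13 = 1) (hψ : ψ ζ = ζ ^ 9) :
    ψ (ζ ^ 3 + ζ ^ 10) = ζ + ζ ^ 12 := by
  have h₁ : (ζ ^ 9) ^ 3 = ζ := by
    rw [← pow_mul, pow_eq_pow_mod _ h, pow_one]
  have h₂ : (ζ ^ 9) ^ 10 = ζ ^ 12 := by
    rw [← pow_mul, pow_eq_pow_mod _ h]
  rw [map_add, map_pow, map_pow, hψ, h₁, h₂]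

end GaussianPeriods

/-- Let `ζ` be a primitive 13th root of unity and `ψ` the field automorphism of `ℚ(ζ)` with
`ψ(ζ) = ζ^9`. Then `ψ` cyclically permutes `A = α·f₁(x,y)`, `B = β·f₂(x,y)`,
`C = γ·f₃(x,y)` for all rational `x, y`; in particular the symmetric expressions
`AB + BC + CA` and `ABC` are fixed by `ψ` (and hence lie in `ℚ(√13)`). -/
theorem psi_permutes_frey_quantities
    (K : Type*) [Field K] (ζ : K) (hζ : IsPrimitiveRoot ζ 13)
    (ψ : K ≃+* K) (hψ : ψ ζ = ζ ^ 9) (x y : ℚ) :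
    ψ (freyA ζ x y) = freyB ζ x y ∧
    ψ (freyB ζ x y) = freyC ζ x y ∧
    ψ (freyC ζ x y) = freyA ζ x y ∧
    ψ (freyA ζ x y * freyB ζ x y + freyB ζ x y * freyC ζ x y +
        freyC ζ x y * freyA ζ x y) =
      freyA ζ x y * freyB ζ x y + freyB ζ x y * freyC ζ x y +
        freyC ζ x y * freyA ζ x y ∧
    ψ (freyA ζ x y * freyB ζ x y * freyC ζ x y) =
      freyA ζ x y * freyB ζ x y * freyC ζ x y := by
  have h₁ := map_first_period hζ.pow_eq_one hψ
  have h₂ := map_second_period hζ.pow_eq_one hψ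
  have h₃ := map_third_period hζ.pow_eq_one hψ
  have hA : ψ (freyA ζ x y) = freyB ζ x y := by
    rw [freyA, map_mul, map_sub, h₂, h₃, map_add, map_add, map_mul, map_mul, h₁]
    simp only [map_pow, map_ratCast, freyB]
  have hB : ψ (freyB ζ x y) = freyC ζ x y := by
    rw [freyB, map_mul, map_sub, h₃, h₁, map_add, map_add, map_mul, map_mul, h₂]
    simp only [map_pow, map_ratCast, freyC]
  have hC : ψ (freyC ζ x y) = freyA ζ x y := by
    rw [freyC, map_mul, map_sub, h₁, h₂, map_add, map_add, map_mul, map_mul, h₃]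
    simp only [map_pow, map_ratCast, freyA]
  refine ⟨hA, hB, hC, ?_, ?_⟩
  · simp only [map_add, map_mul, hA, hB, hC]
    ring
  · simp only [map_mul, hA, hB, hC]
    ring
end

section
/- Let ζ be a primitive 13th root of unity, set c₁ = ζ + ζ^12, c₂ = ζ^4 + ζ^9, c₃ = ζ^3 + ζ^10, and fᵢ(x,y) = x² + cᵢ·xy + y². Let a, b be coprime integers. Then for any i ≠ j in {1,2,3}, every prime ideal of ℤ[ζ] containing both fᵢ(a,b) and fⱼ(a,b) contains 13. In other words, f₁(a,b), f₂(a,b), f₃(a,b) are pairwise coprime outside the prime above 13. -/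
open NumberField

/-- `fᵢ(a,b) = a² + (ζ^k + ζ^(13-k))·ab + b²` for `k ∈ {1,4,3}`, the quadratic factors of
`φ₁` evaluated at `(a,b)`, in the ring of integers `ℤ[ζ]` of `ℚ(ζ)`. -/
def quadFactor {R : Type*} [CommRing R] (ζ : R) (k : ℕ) (a b : ℤ) : R :=
  (a : R) ^ 2 + (ζ ^ k + ζ ^ (13 - k)) * (a : R) * (b : R) + (b : R) ^ 2

/-- In a domain, if `z ^ n = 1` and `z ^ k + z ^ (-k) = z ^ l + z ^ (-l)`, then `z ^ k` equals
`z ^ l` or its inverse. -/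
lemma pow_eq_pow_or_pow_add_eq_one {R : Type*} [CommRing R] [IsDomain R] {z : R} {n k l : ℕ}
    (hz : z ^ n = 1) (hk : k ≤ n) (hl : l ≤ n)
    (h : z ^ k + z ^ (n - k) = z ^ l + z ^ (n - l)) :
    z ^ k = z ^ l ∨ z ^ (k + l) = 1 := by
  have hk' : z ^ k * z ^ (n - k) = 1 := by rw [← pow_add, Nat.add_sub_cancel' hk, hz]
  have hl' : z ^ l * z ^ (n - l) = 1 := by rw [← pow_add, Nat.add_sub_cancel' hl, hz]
  have key : (z ^ k - z ^ l) * (z ^ (k + l) - 1) = 0 := by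
    rw [pow_add]
    linear_combination z ^ k * z ^ l * h - z ^ l * hk' + z ^ k * hl'
  exact (mul_eq_zero.mp key).imp sub_eq_zero.mp sub_eq_zero.mp

/-- If two quadratic factors with distinct `k, l ∈ {1, 4, 3}` have a common zero at coprime
integers in a domain where `z ^ 13 = 1`, then `z = 1`. -/
lemma eq_one_of_quadFactor_eq_zero {R : Type*} [CommRing R] [IsDomain R] {z : R}
    (hz : z ^ 13 = 1) {a b : ℤ} (hab : IsCoprime a b) {k l : ℕ}
    (hk : k ∈ ({1, 4, 3} : Finset ℕ)) (hl : l ∈ ({1, 4, 3} : Finset ℕ)) (hkl : k ≠ l)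
    (hka : quadFactor z k a b = 0) (hla : quadFactor z l a b = 0) : z = 1 := by
  have hR : IsCoprime (a : R) (b : R) := hab.map (Int.castRingHom R)
  unfold quadFactor at hka hla
  have ha : (a : R) ≠ 0 := by
    intro ha
    have hb : (b : R) = 0 := by simpa [ha] using hka
    rw [ha, hb] at hR
    exact not_isCoprime_zero_zero hR
  have hb : (b : R) ≠ 0 := by
    intro hb
    exact ha (by simpa [hb] using hka)
  have hc : z ^ k + z ^ (13 - k) = z ^ l + z ^ (13 - l) := by
    apply mul_right_cancel₀ (mul_ne_zero ha hb)
    linear_combination hka - hla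
  have hk13 : k ≤ 13 := by simp at hk; omega
  have hl13 : l ≤ 13 := by simp at hl; omega
  obtain ⟨m, hm, hmz⟩ : ∃ m : ℕ, Nat.gcd m 13 = 1 ∧ z ^ m = 1 := by
    rcases pow_eq_pow_or_pow_add_eq_one hz hk13 hl13 hc with h | h
    · refine ⟨k + (13 - l), ?_, ?_⟩
      · fin_cases hk <;> fin_cases hl <;> simp_all
      · rw [pow_add, h, ← pow_add, Nat.add_sub_cancel' hl13, hz]
    · refine ⟨k + l, ?_, h⟩
      fin_cases hk <;> fin_cases hl <;> simp_all
  simpa [hm] using pow_gcd_eq_one.mpr ⟨hmz, hz⟩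

/-- Let `ζ` be a primitive 13th root of unity and `a, b` coprime integers. The values
`f₁(a,b), f₂(a,b), f₃(a,b)` (corresponding to `k ∈ {1,4,3}`) are pairwise coprime outside
the prime above 13: any prime ideal of `ℤ[ζ]` containing two of them contains `13`. -/
theorem quad_factors_pairwise_coprime_outside_13
    (K : Type) [Field K] [Algebra ℚ K] [IsCyclotomicExtension {13} ℚ K]
    (ζ : 𝓞 K) (hζ : IsPrimitiveRoot ζ 13)
    (a b : ℤ) (hab : IsCoprime a b)
    (k l : ℕ) (hk : k ∈ ({1, 4, 3} : Finset ℕ)) (hl : l ∈ ({1, 4, 3} : Finset ℕ))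
    (hkl : k ≠ l)
    (P : Ideal (𝓞 K)) (hP : P.IsPrime)
    (hkP : quadFactor ζ k a b ∈ P) (hlP : quadFactor ζ l a b ∈ P) :
    (13 : 𝓞 K) ∈ P := by
  have hz : Ideal.Quotient.mk P ζ ^ 13 = 1 := by rw [← map_pow, hζ.pow_eq_one, map_one]
  have hmap (m : ℕ) (hm : quadFactor ζ m a b ∈ P) :
      quadFactor (Ideal.Quotient.mk P ζ) m a b = 0 := by
    simpa [quadFactor] using Ideal.Quotient.eq_zero_iff_mem.mpr hm
  have h1 : Ideal.Quotient.mk P ζ = 1 :=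
    eq_one_of_quadFactor_eq_zero hz hab hk hl hkl (hmap k hkP) (hmap l hlP)
  have hsum := congrArg (Ideal.Quotient.mk P) (hζ.geom_sum_eq_zero (by norm_num))
  rw [← Ideal.Quotient.eq_zero_iff_mem, map_ofNat]
  simpa [h1] using hsum
end

section
/- Let p be a prime with p > 97, let F be a field of characteristic p, and let a be an integer with |a| ≤ 3. Then there is no element x ∈ F satisfying both x^12 = 1 and x² − a·x + 3 = 0 (where a and 3 are viewed in F via the canonical ring map ℤ → F). Equivalently, for every integer a with |a| ≤ 3, the resultant of x^12 − 1 and x² − a·x + 3 is a nonzero integer all of whose prime divisors are at most 97. -/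
/-- An integer strictly between `0` and `194` that vanishes in characteristic `p > 97`
is equal to `p`. -/
lemma eq_char_of_cast_eq_zero {p : ℕ} (hp97 : 97 < p) {F : Type*} [Field F] [CharP F p]
    {n : ℤ} (hpos : 0 < n) (hlt : n < 194) (h : (n : F) = 0) : n = p := by
  obtain ⟨k, rfl⟩ := (CharP.intCast_eq_zero_iff F p n).mp h
  have hp : (97 : ℤ) < p := by exact_mod_cast hp97
  have hk : 0 < k := pos_of_mul_pos_right hpos (by lia)
  have hk' : k < 2 := by nlinarith
  obtain rfl : k = 1 := by lia
  simp

/-- The factorization of `x ^ 12 - 1` into cyclotomic polynomials. -/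
lemma pow_twelve_sub_one_eq_prod {R : Type*} [CommRing R] (x : R) :
    x ^ 12 - 1 = (x - 1) * ((x + 1) * ((x ^ 2 + 1) * ((x ^ 2 + x + 1) *
      ((x ^ 2 - x + 1) * (x ^ 4 - x ^ 2 + 1))))) := by
  ring

/-- If `p > 97` is a prime, `F` is a field of characteristic `p`, and `a` is an integer with
`|a| ≤ 3`, then no element `x` of `F` satisfies both `x^12 = 1` and `x² - a·x + 3 = 0`. -/
theorem no_common_root_of_resultant
    (p : ℕ) (hp : p.Prime) (hp97 : 97 < p)
    (F : Type*) [Field F] [CharP F p]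
    (a : ℤ) (ha : |a| ≤ 3) :
    ¬ ∃ x : F, x ^ 12 = 1 ∧ x ^ 2 - (a : F) * x + 3 = 0 := by
  rintro ⟨x, hx, hq⟩
  obtain ⟨hlo, hhi⟩ := abs_le.mp ha
  have hsq : a ^ 2 ≤ 9 := by nlinarith
  have hpz : (97 : ℤ) < p := by exact_mod_cast hp97
  have small {n : ℤ} (hpos : 0 < n) (hle : n ≤ 97) : (n : F) ≠ 0 := fun h => by
    have := eq_char_of_cast_eq_zero hp97 hpos (by lia) h
    lia
  have hprod := pow_twelve_sub_one_eq_prod x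
  rw [hx, sub_self, eq_comm] at hprod
  simp only [mul_eq_zero] at hprod
  rcases hprod with h | h | h | h | h | h
  · refine small (n := 4 - a) (by lia) (by lia) ?_
    push_cast
    linear_combination hq - (x + 1 - a) * h
  · refine small (n := 4 + a) (by lia) (by lia) ?_
    push_cast
    linear_combination hq - (x - 1 - a) * h
  · refine small (n := a ^ 2 + 4) (by positivity) (by lia) ?_
    have hlin : (a : F) * x = 2 := by linear_combination h - hq
    push_cast
    linear_combination (a : F) ^ 2 * h - (a * x + 2) * hlin
  · refine small (n := (a + 1) ^ 2 + 2 * (a + 1) + 4) (by nlinarith) (by nlinarith) ?_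
    have hlin : ((a : F) + 1) * x = 2 := by linear_combination h - hq
    push_cast
    linear_combination ((a : F) + 1) ^ 2 * h - ((a + 1) * x + 2 + (a + 1)) * hlin
  · refine small (n := (a - 1) ^ 2 - 2 * (a - 1) + 4) (by nlinarith) (by nlinarith) ?_
    have hlin : ((a : F) - 1) * x = 2 := by linear_combination h - hq
    push_cast
    linear_combination ((a : F) - 1) ^ 2 * h - ((a - 1) * x + 2 - (a - 1)) * hlin
  · have hlin : ((a : F) ^ 2 - 7) * x ^ 2 = 8 := by
      linear_combination h - (x ^ 2 + 3 + a * x) * hq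
    have hres : (((a ^ 2 - 7) ^ 2 - 8 * (a ^ 2 - 7) + 64 : ℤ) : F) = 0 := by
      push_cast
      linear_combination ((a : F) ^ 2 - 7) ^ 2 * h
        - ((a ^ 2 - 7) * x ^ 2 + 8 - (a ^ 2 - 7)) * hlin
    have heq := eq_char_of_cast_eq_zero hp97 (by nlinarith) (by nlinarith [sq_nonneg a]) hres
    have hprime : Prime ((a ^ 2 - 7) ^ 2 - 8 * (a ^ 2 - 7) + 64) :=
      heq ▸ Nat.prime_iff_prime_int.mp hp
    rw [Int.prime_iff_natAbs_prime] at hprime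
    interval_cases a <;> first | lia | norm_num at hprime
end
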